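/- Let L = A_8 x A_8 x A_8 inside Z^27, with bilinear form the restriction of the standard form on Z^27, and let q be the quadratic form on L/2L given by q(v+2L) = (<v,v>/2) mod 2. Let X, Y be subgroups of A_8 containing 2A_8 such that X/2A_8 and Y/2A_8 are 4-dimensional totally singular subspaces of (A_8/2A_8, q) and X + Y = A_8. Define Phi to be the subgroup of L generated by {(alpha,-alpha,0) : alpha in A_8}, {(gamma,gamma,gamma) : gamma in X} and 2L, and Psi the subgroup generated by {(0,alpha,-alpha) : alpha in A_8}, {(gamma,gamma,gamma) : gamma in Y} and 2L. Then Phi/2L and Psi/2L are 12-dimensional maximal totally singular subspaces of the 24-dimensional quadratic F_2-space (L/2L, q), and Phi + Psi = L. -/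

import Mathlib

/-- The root lattice `A₈ = {a ∈ ℤ⁹ : a₁ + ⋯ + a₉ = 0}` as an additive subgroup of `ℤ⁹`. -/
def A8lat : AddSubgroup (Fin 9 → ℤ) where
  carrier := {a | ∑ i, a i = 0}
  add_mem' := by
    intro a b ha hb
    simp only [Set.mem_setOf_eq, Pi.add_apply, Finset.sum_add_distrib] at *
    simp [ha, hb]
  zero_mem' := by simp
  neg_mem' := by
    intro a ha
    simp only [Set.mem_setOf_eq, Pi.neg_apply, Finset.sum_neg_distrib] at *
    simp [ha]

/-- The sublattice `2A₈` as an additive subgroup of `ℤ⁹`. -/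
def twoA8lat : AddSubgroup (Fin 9 → ℤ) where
  carrier := {a | ∃ c : Fin 9 → ℤ, (∑ i, c i = 0) ∧ ∀ i, a i = 2 * c i}
  zero_mem' := ⟨0, by simp, fun i => by simp⟩
  add_mem' := by
    rintro a b ⟨c, hc, hac⟩ ⟨d, hd, hbd⟩
    refine ⟨c + d, by simp [Finset.sum_add_distrib, hc, hd], fun i => ?_⟩
    simp only [Pi.add_apply, hac i, hbd i]
    ring
  neg_mem' := by
    rintro a ⟨c, hc, hac⟩
    refine ⟨-c, by simp [Finset.sum_neg_distrib, hc], fun i => ?_⟩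
    simp only [Pi.neg_apply, hac i]
    ring

/-- The lattice `L = A₈ × A₈ × A₈` (inside `ℤ²⁷ = ℤ³ˣ⁹`). -/
def Llat : AddSubgroup (Fin 3 → Fin 9 → ℤ) where
  carrier := {v | ∀ k, ∑ i, v k i = 0}
  add_mem' := by
    intro a b ha hb k
    simp only [Pi.add_apply, Finset.sum_add_distrib]
    simp [ha k, hb k]
  zero_mem' := by simp
  neg_mem' := by
    intro a ha k
    simp only [Pi.neg_apply, Finset.sum_neg_distrib]
    simp [ha k]

/-- The sublattice `2L` of `L = A₈³`. -/
def twoLlat : AddSubgroup (Fin 3 → Fin 9 → ℤ) where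
  carrier := {v | ∃ c : Fin 3 → Fin 9 → ℤ, (∀ k, ∑ i, c k i = 0) ∧ ∀ k i, v k i = 2 * c k i}
  zero_mem' := ⟨0, by simp, fun k i => by simp⟩
  add_mem' := by
    rintro a b ⟨c, hc, hac⟩ ⟨d, hd, hbd⟩
    refine ⟨c + d, fun k => by simp [Finset.sum_add_distrib, hc k, hd k], fun k i => ?_⟩
    simp only [Pi.add_apply, hac k i, hbd k i]
    ring
  neg_mem' := by
    rintro a ⟨c, hc, hac⟩
    refine ⟨-c, fun k => by simp [Finset.sum_neg_distrib, hc k], fun k i => ?_⟩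
    simp only [Pi.neg_apply, hac k i]
    ring

/-- If `f` detects membership in `K` on the subgroup `H`, then `H / (K ∩ H)` has as many elements
as the image of `H` under `f`. -/
theorem card_quotient_addSubgroupOf_eq_card_map {G M : Type*} [AddCommGroup G] [AddCommGroup M]
    (f : G →+ M) (K H : AddSubgroup G) (h : ∀ x ∈ H, x ∈ K ↔ f x = 0) :
    Nat.card (↥H ⧸ K.addSubgroupOf H) = Nat.card (H.map f) := by
  have hker : K.addSubgroupOf H = (f.comp H.subtype).ker := by
    ext x
    simpa [AddSubgroup.mem_addSubgroupOf] using h x x.2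
  have hrange : (f.comp H.subtype).range = H.map f := by
    rw [AddMonoidHom.range_comp, AddSubgroup.range_subtype]
  rw [hker, ← hrange]
  exact Nat.card_congr (QuotientAddGroup.quotientKerEquivRange _).toEquiv

/-- Coordinatewise reduction modulo `2`. -/
def reduceModTwo (ι : Type*) : (ι → ℤ) →+ (ι → ZMod 2) :=
  (Int.castAddHom (ZMod 2)).compLeft ι

theorem reduceModTwo_apply {ι : Type*} (a : ι → ℤ) (i : ι) :
    reduceModTwo ι a i = (a i : ZMod 2) := rfl

theorem mem_A8lat {a : Fin 9 → ℤ} : a ∈ A8lat ↔ ∑ i, a i = 0 := Iff.rfl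

theorem mem_twoA8lat_iff {a : Fin 9 → ℤ} (ha : a ∈ A8lat) :
    a ∈ twoA8lat ↔ reduceModTwo (Fin 9) a = 0 := by
  constructor
  · rintro ⟨c, -, hc⟩
    funext i
    rw [reduceModTwo_apply, hc i, Pi.zero_apply, ZMod.intCast_zmod_eq_zero_iff_dvd]
    exact ⟨c i, rfl⟩
  · intro h
    have hdvd : ∀ i, ∃ c, a i = 2 * c := fun i =>
      (ZMod.intCast_zmod_eq_zero_iff_dvd (a i) 2).1 (congrFun h i)
    choose c hc using hdvd
    refine ⟨c, ?_, hc⟩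
    have hsum : 2 * ∑ i, c i = 0 := by
      rw [Finset.mul_sum, ← mem_A8lat.1 ha]
      exact Finset.sum_congr rfl fun i _ => (hc i).symm
    lia

theorem mem_twoLlat {v : Fin 3 → Fin 9 → ℤ} : v ∈ twoLlat ↔ ∀ k, v k ∈ twoA8lat := by
  constructor
  · rintro ⟨c, hc, hv⟩ k
    exact ⟨c k, hc k, hv k⟩
  · intro h
    choose c hc hv using h
    exact ⟨c, hc, hv⟩

theorem mem_Llat {v : Fin 3 → Fin 9 → ℤ} : v ∈ Llat ↔ ∀ k, v k ∈ A8lat := Iff.rfl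

theorem add_self_mem_twoA8lat {a : Fin 9 → ℤ} (ha : a ∈ A8lat) : a + a ∈ twoA8lat :=
  ⟨a, ha, fun i => by rw [Pi.add_apply, two_mul]⟩

theorem twoA8lat_le_A8lat : twoA8lat ≤ A8lat := by
  rintro a ⟨c, hc, ha⟩
  rw [mem_A8lat, Finset.sum_congr rfl fun i _ => ha i, ← Finset.mul_sum, hc, mul_zero]

theorem card_A8lat_quotient : Nat.card (↥A8lat ⧸ twoA8lat.addSubgroupOf A8lat) = 256 := by
  let f : (Fin 9 → ℤ) →+ (Fin 8 → ZMod 2) :=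
    { toFun := fun a i => (a i.castSucc : ZMod 2)
      map_zero' := by funext i; simp
      map_add' := fun a b => by funext i; simp }
  have hf : ∀ a ∈ A8lat, a ∈ twoA8lat ↔ f a = 0 := by
    intro a ha
    rw [mem_twoA8lat_iff ha]
    constructor
    · intro h
      funext i
      exact congrFun h i.castSucc
    · intro h
      have hsum := congrArg (Int.cast : ℤ → ZMod 2) (mem_A8lat.1 ha)
      have h' : ∀ i : Fin 8, (a i.castSucc : ZMod 2) = 0 := fun i => congrFun h i
      funext i
      rw [Fin.sum_univ_castSucc] at hsum
      push_cast at hsum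
      rw [Finset.sum_eq_zero fun i _ => h' i, zero_add] at hsum
      exact Fin.lastCases hsum h' i
  have htop : A8lat.map f = ⊤ := by
    refine eq_top_iff.2 fun w _ => ?_
    choose g hg using fun i => ZMod.intCast_surjective (w i)
    refine ⟨Fin.snoc (α := fun _ => ℤ) g (-∑ i, g i), ?_, ?_⟩
    · refine mem_A8lat.2 ?_
      rw [Fin.sum_univ_castSucc]
      simp only [Fin.snoc_castSucc, Fin.snoc_last, add_neg_cancel]
    · funext i
      simp [f, hg]
  rw [card_quotient_addSubgroupOf_eq_card_map f _ _ hf, htop, AddSubgroup.card_top]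
  simp

/-- The sublattice of `L` of all `v` with `v_i + v_j ∈ 2A₈` and `v_k ∈ X`, where
`(i, j, k) = (σ 0, σ 1, σ 2)`. -/
def gluedLattice (σ : Equiv.Perm (Fin 3)) (X : AddSubgroup (Fin 9 → ℤ)) :
    AddSubgroup (Fin 3 → Fin 9 → ℤ) where
  carrier := {v | v ∈ Llat ∧ v (σ 0) + v (σ 1) ∈ twoA8lat ∧ v (σ 2) ∈ X}
  zero_mem' := ⟨zero_mem _, by simp [zero_mem], zero_mem _⟩
  add_mem' := by
    rintro a b ⟨ha, ha', ha''⟩ ⟨hb, hb', hb''⟩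
    refine ⟨add_mem ha hb, ?_, add_mem ha'' hb''⟩
    simpa [add_add_add_comm] using add_mem ha' hb'
  neg_mem' := by
    rintro a ⟨ha, ha', ha''⟩
    refine ⟨neg_mem ha, ?_, neg_mem ha''⟩
    simpa [add_comm] using neg_mem ha'

theorem even_sum_mul_self {a : Fin 9 → ℤ} (ha : a ∈ A8lat) : (2 : ℤ) ∣ ∑ i, a i * a i := by
  have h : (2 : ℤ) ∣ ∑ i, a i * a i - ∑ i, a i := by
    rw [← Finset.sum_sub_distrib]
    refine Finset.dvd_sum fun i _ => ?_
    rw [← mul_sub_one]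
    exact (Int.even_mul_pred_self (a i)).two_dvd
  rwa [mem_A8lat.1 ha, sub_zero] at h

theorem four_dvd_of_mem_gluedLattice (σ : Equiv.Perm (Fin 3)) {X : AddSubgroup (Fin 9 → ℤ)}
    (hX : ∀ a ∈ X, (4 : ℤ) ∣ ∑ i, a i * a i) {v : Fin 3 → Fin 9 → ℤ}
    (hv : v ∈ gluedLattice σ X) : (4 : ℤ) ∣ ∑ k, ∑ i, v k i * v k i := by
  obtain ⟨hL, ⟨c, hc, hvc⟩, hvX⟩ := hv
  rw [← Equiv.sum_comp σ, Fin.sum_univ_three]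
  refine dvd_add ?_ (hX _ hvX)
  have hd : v (σ 0) - c ∈ A8lat := sub_mem (hL _) hc
  have h : ∑ i, v (σ 0) i * v (σ 0) i + ∑ i, v (σ 1) i * v (σ 1) i =
      2 * ∑ i, (v (σ 0) - c) i * (v (σ 0) - c) i + 2 * ∑ i, c i * c i := by
    rw [Finset.mul_sum, Finset.mul_sum, ← Finset.sum_add_distrib, ← Finset.sum_add_distrib]
    refine Finset.sum_congr rfl fun i _ => ?_
    have h1 : v (σ 1) i = 2 * c i - v (σ 0) i := by
      rw [← hvc i, Pi.add_apply, add_sub_cancel_left]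
    rw [h1, Pi.sub_apply]
    ring
  rw [h]
  exact dvd_add (mul_dvd_mul_left 2 (even_sum_mul_self hd))
    (mul_dvd_mul_left 2 (even_sum_mul_self hc))

theorem Fin.forall_fin_three_perm (σ : Equiv.Perm (Fin 3)) {p : Fin 3 → Prop} :
    (∀ k, p k) ↔ p (σ 0) ∧ p (σ 1) ∧ p (σ 2) := by
  rw [← σ.forall_congr_right, Fin.forall_fin_succ, Fin.forall_fin_two]
  rfl

theorem card_gluedLattice_quotient (σ : Equiv.Perm (Fin 3)) {X : AddSubgroup (Fin 9 → ℤ)}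
    (hXA : X ≤ A8lat) (hX : Nat.card (↥X ⧸ twoA8lat.addSubgroupOf X) = 16) :
    Nat.card (↥(gluedLattice σ X) ⧸ twoLlat.addSubgroupOf (gluedLattice σ X)) = 4096 := by
  let r := reduceModTwo (Fin 9)
  let p : Fin 3 → ((Fin 3 → Fin 9 → ℤ) →+ (Fin 9 → ZMod 2)) :=
    fun k => r.comp (Pi.evalAddMonoidHom _ k)
  let f := (p (σ 0)).prod (p (σ 2))
  have hf : ∀ v ∈ gluedLattice σ X, v ∈ twoLlat ↔ f v = 0 := by
    intro v hv
    have hfv : f v = 0 ↔ v (σ 0) ∈ twoA8lat ∧ v (σ 2) ∈ twoA8lat := by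
      rw [mem_twoA8lat_iff (hv.1 _), mem_twoA8lat_iff (hv.1 _)]
      exact Prod.mk_eq_zero
    rw [hfv, mem_twoLlat, Fin.forall_fin_three_perm σ]
    exact ⟨fun h => ⟨h.1, h.2.2⟩, fun h => ⟨h.1, (add_mem_cancel_left h.1).1 hv.2.1, h.2⟩⟩
  have hmap : (gluedLattice σ X).map f = (A8lat.map r).prod (X.map r) := by
    ext w
    rw [AddSubgroup.mem_prod]
    constructor
    · rintro ⟨v, hv, rfl⟩
      exact ⟨⟨_, hv.1 _, rfl⟩, ⟨_, hv.2.2, rfl⟩⟩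
    · rintro ⟨⟨a, ha, ha'⟩, ⟨x, hx, hx'⟩⟩
      have h0 : σ 0 ≠ σ 2 := σ.injective.ne (by decide)
      have h1 : σ 1 ≠ σ 2 := σ.injective.ne (by decide)
      refine ⟨fun k => if k = σ 2 then x else a, ⟨?_, ?_, ?_⟩, ?_⟩
      · rw [mem_Llat]
        intro k
        split_ifs
        exacts [hXA hx, ha]
      · simpa [h0, h1] using add_self_mem_twoA8lat ha
      · simpa using hx
      · refine Prod.ext ?_ ?_
        · simpa [f, p, h0] using ha'
        · simpa [f, p] using hx'
  rw [card_quotient_addSubgroupOf_eq_card_map f _ _ hf, hmap,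
    Nat.card_congr (AddSubgroup.prodEquiv _ _).toEquiv, Nat.card_prod,
    ← card_quotient_addSubgroupOf_eq_card_map r twoA8lat A8lat fun _ h => mem_twoA8lat_iff h,
    ← card_quotient_addSubgroupOf_eq_card_map r twoA8lat X fun _ h => mem_twoA8lat_iff (hXA h),
    card_A8lat_quotient, hX]

/-- The standard dot product on `𝔽₂²⁷ = 𝔽₂³ˣ⁹`. -/
def dotForm : LinearMap.BilinForm (ZMod 2) (Fin 3 → Fin 9 → ZMod 2) :=
  LinearMap.mk₂ (ZMod 2) (fun u v => ∑ k, u k ⬝ᵥ v k)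
    (fun u v w => by simp [Finset.sum_add_distrib])
    (fun c u v => by simp [Finset.mul_sum])
    (fun u v w => by simp [Finset.sum_add_distrib])
    (fun c u v => by simp [Finset.mul_sum])

theorem dotForm_apply (u v : Fin 3 → Fin 9 → ZMod 2) : dotForm u v = ∑ k, u k ⬝ᵥ v k := rfl

theorem dotForm_isSymm : dotForm.IsSymm :=
  ⟨fun u v => by simp [dotForm_apply, dotProduct_comm]⟩

theorem dotForm_nondegenerate : dotForm.Nondegenerate := by
  refine dotForm_isSymm.isRefl.nondegenerate_iff_separatingLeft.2 fun u hu => ?_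
  funext k i
  have h := hu (Pi.single k (Pi.single i 1))
  rw [dotForm_apply, Finset.sum_eq_single k (fun j _ hj => by simp [hj]) (by simp)] at h
  simpa using h

/-- A totally isotropic subspace of `𝔽₂²⁷ = 𝔽₂³ˣ⁹` all of whose vectors have even weight in each
of the three blocks has dimension at most `12`. -/
theorem finrank_le_of_isotropic (W : Submodule (ZMod 2) (Fin 3 → Fin 9 → ZMod 2))
    (heven : ∀ w ∈ W, ∀ k, ∑ i, w k i = 0) (hiso : ∀ u ∈ W, ∀ w ∈ W, dotForm u w = 0) :
    Module.finrank (ZMod 2) W ≤ 12 := by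
  let d : (Fin 3 → ZMod 2) →ₗ[ZMod 2] (Fin 3 → Fin 9 → ZMod 2) :=
    { toFun := fun c k _ => c k
      map_add' := fun _ _ => rfl
      map_smul' := fun _ _ => rfl }
  have hd : Function.Injective d := fun c c' h => funext fun k => congrFun (congrFun h k) 0
  have hdrank : Module.finrank (ZMod 2) (LinearMap.range d) = 3 := by
    rw [LinearMap.finrank_range_of_inj hd, Module.finrank_fin_fun]
  have hdisj : W ⊓ LinearMap.range d = ⊥ := by
    refine (Submodule.eq_bot_iff _).2 ?_
    rintro _ ⟨hw, c, rfl⟩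
    have hc : c = 0 := by
      funext k
      have h : ∑ _i : Fin 9, c k = 0 := heven _ hw k
      rw [Finset.sum_const, Finset.card_univ, Fintype.card_fin] at h
      generalize c k = x at h
      change x = 0
      revert x
      decide
    rw [hc, map_zero]
  have hle : W ⊔ LinearMap.range d ≤ dotForm.orthogonal W := by
    refine sup_le (fun u hu w hw => hiso w hw u hu) ?_
    rintro _ ⟨c, rfl⟩ w hw
    change dotForm w (d c) = 0
    rw [dotForm_apply]
    refine Finset.sum_eq_zero fun k _ => ?_
    change ∑ i, w k i * c k = 0
    rw [← Finset.sum_mul, heven w hw k, zero_mul]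
  have hrank := Submodule.finrank_mono hle
  have hsum := Submodule.finrank_sup_add_finrank_inf_eq W (LinearMap.range d)
  have htotal : Module.finrank (ZMod 2) (Fin 3 → Fin 9 → ZMod 2) = 27 := by
    simp [Module.finrank_pi_fintype]
  rw [LinearMap.BilinForm.finrank_orthogonal dotForm_nondegenerate, htotal] at hrank
  rw [hdisj, finrank_bot, hdrank] at hsum
  lia

theorem even_sum_mul_of_four_dvd {Z : AddSubgroup (Fin 3 → Fin 9 → ℤ)}
    (hZ : ∀ v ∈ Z, (4 : ℤ) ∣ ∑ k, ∑ i, v k i * v k i) {u v : Fin 3 → Fin 9 → ℤ}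
    (hu : u ∈ Z) (hv : v ∈ Z) : (2 : ℤ) ∣ ∑ k, ∑ i, u k i * v k i := by
  have h : ∑ k, ∑ i, (u + v) k i * (u + v) k i = ∑ k, ∑ i, u k i * u k i +
      ∑ k, ∑ i, v k i * v k i + 2 * ∑ k, ∑ i, u k i * v k i := by
    simp only [Finset.mul_sum, ← Finset.sum_add_distrib, Pi.add_apply]
    refine Finset.sum_congr rfl fun k _ => Finset.sum_congr rfl fun i _ => ?_
    ring
  have h1 := hZ _ (add_mem hu hv)
  have h2 := hZ u hu
  have h3 := hZ v hv
  lia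

theorem card_quotient_le_of_totally_singular (Z : AddSubgroup (Fin 3 → Fin 9 → ℤ))
    (hZL : Z ≤ Llat) (hZ : ∀ v ∈ Z, (4 : ℤ) ∣ ∑ k, ∑ i, v k i * v k i) :
    Nat.card (↥Z ⧸ twoLlat.addSubgroupOf Z) ≤ 4096 := by
  let f : (Fin 3 → Fin 9 → ℤ) →+ (Fin 3 → Fin 9 → ZMod 2) :=
    (reduceModTwo (Fin 9)).compLeft (Fin 3)
  have hf : ∀ v ∈ Z, v ∈ twoLlat ↔ f v = 0 := by
    intro v hv
    rw [mem_twoLlat, funext_iff]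
    exact forall_congr' fun k => mem_twoA8lat_iff (hZL hv k)
  rw [card_quotient_addSubgroupOf_eq_card_map f _ _ hf]
  let W : Submodule (ZMod 2) (Fin 3 → Fin 9 → ZMod 2) := AddSubgroup.toZModSubmodule 2 (Z.map f)
  have hW : Module.finrank (ZMod 2) W ≤ 12 := by
    apply finrank_le_of_isotropic
    · rintro _ ⟨v, hv, rfl⟩ k
      have h := congrArg (Int.cast : ℤ → ZMod 2) (hZL hv k)
      rwa [Int.cast_sum, Int.cast_zero] at h
    · rintro _ ⟨u, hu, rfl⟩ _ ⟨v, hv, rfl⟩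
      have h := (ZMod.intCast_zmod_eq_zero_iff_dvd _ 2).2 (even_sum_mul_of_four_dvd hZ hu hv)
      push_cast at h
      exact h
  have hcard : Nat.card (Z.map f) = 2 ^ Module.finrank (ZMod 2) W := by
    have h := Module.natCard_eq_pow_finrank (K := ZMod 2) (V := W)
    rwa [Nat.card_zmod] at h
  rw [hcard]
  exact Nat.pow_le_pow_right two_pos hW

theorem closure_sup_twoLlat_eq_gluedLattice (σ : Equiv.Perm (Fin 3))
    {X : AddSubgroup (Fin 9 → ℤ)} (hX2 : twoA8lat ≤ X) (hXA : X ≤ A8lat) :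
    AddSubgroup.closure
      ({v | ∃ a : Fin 9 → ℤ, (∑ i, a i = 0) ∧ v = Pi.single (σ 0) a - Pi.single (σ 1) a} ∪
       {v | ∃ g ∈ X, v = fun _ => g}) ⊔ twoLlat = gluedLattice σ X := by
  have h01 : σ 0 ≠ σ 1 := σ.injective.ne (by decide)
  have h02 : σ 0 ≠ σ 2 := σ.injective.ne (by decide)
  have h12 : σ 1 ≠ σ 2 := σ.injective.ne (by decide)
  apply le_antisymm
  · refine sup_le ((AddSubgroup.closure_le _).2 ?_) ?_
    · rintro _ (⟨a, ha, rfl⟩ | ⟨g, hg, rfl⟩)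
      · refine ⟨mem_Llat.2 ((Fin.forall_fin_three_perm σ).2 ?_), ?_, ?_⟩
        · have ha' : a ∈ A8lat := ha
          simp [h01, h01.symm, h02.symm, h12.symm, ha', zero_mem]
        · simp [h01, h01.symm, zero_mem]
        · simp [h02.symm, h12.symm, zero_mem]
      · exact ⟨fun _ => hXA hg, add_self_mem_twoA8lat (hXA hg), hg⟩
    · intro v hv
      have hv' := mem_twoLlat.1 hv
      exact ⟨fun k => twoA8lat_le_A8lat (hv' k), add_mem (hv' _) (hv' _), hX2 (hv' _)⟩
  · rintro v ⟨hL, h2, hX⟩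
    have hdecomp : v = ((Pi.single (σ 0) (v (σ 0) - v (σ 2)) - Pi.single (σ 1) (v (σ 0) - v (σ 2)))
        + (fun _ => v (σ 2))) +
        Pi.single (σ 1) (v (σ 0) + v (σ 1) - (v (σ 2) + v (σ 2))) := by
      rw [funext_iff, Fin.forall_fin_three_perm σ]
      refine ⟨?_, ?_, ?_⟩
      · simp [h01]
      · simp [h01.symm]
        abel
      · simp [h02.symm, h12.symm]
    rw [hdecomp]
    refine AddSubgroup.add_mem_sup (add_mem ?_ ?_) ?_
    · exact AddSubgroup.subset_closure (Or.inl
        ⟨_, mem_A8lat.1 (sub_mem (hL (σ 0)) (hL (σ 2))), rfl⟩)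
    · exact AddSubgroup.subset_closure (Or.inr ⟨_, hX, rfl⟩)
    · refine mem_twoLlat.2 fun k => ?_
      rw [Pi.single_apply]
      split_ifs
      exacts [sub_mem h2 (add_self_mem_twoA8lat (hL _)), zero_mem _]

theorem gluedLattice_sup_eq_Llat {X Y : AddSubgroup (Fin 9 → ℤ)}
    (hXA : X ≤ A8lat) (hYA : Y ≤ A8lat) (hXY : X ⊔ Y = A8lat) :
    gluedLattice 1 X ⊔ gluedLattice (finRotate 3) Y = Llat := by
  refine le_antisymm (sup_le (fun v hv => hv.1) fun v hv => hv.1) fun v hv => ?_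
  have hs : v 0 + v 1 + v 2 ∈ X ⊔ Y := by
    rw [hXY]
    exact add_mem (add_mem (hv 0) (hv 1)) (hv 2)
  obtain ⟨x, hx, y, hy, hxy⟩ := AddSubgroup.mem_sup.1 hs
  refine AddSubgroup.mem_sup.2 ⟨![v 0 - y, y - v 0, x], ⟨?_, ?_, ?_⟩,
    v - ![v 0 - y, y - v 0, x], ⟨?_, ?_, ?_⟩, add_sub_cancel _ _⟩
  · rw [mem_Llat, Fin.forall_fin_succ, Fin.forall_fin_two]
    exact ⟨sub_mem (hv 0) (hYA hy), sub_mem (hYA hy) (hv 0), hXA hx⟩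
  · simp [zero_mem]
  · simpa using hx
  · rw [mem_Llat, Fin.forall_fin_succ, Fin.forall_fin_two]
    exact ⟨sub_mem (hv 0) (sub_mem (hv 0) (hYA hy)), sub_mem (hv 1) (sub_mem (hYA hy) (hv 0)),
      sub_mem (hv 2) (hXA hx)⟩
  · have h : v 1 - (y - v 0) + (v 2 - x) = 0 := by
      have h' : v 1 - (y - v 0) + (v 2 - x) = v 0 + v 1 + v 2 - (x + y) := by abel
      rw [h', hxy, sub_self]
    change v 1 - (y - v 0) + (v 2 - x) ∈ twoA8lat
    rw [h]
    exact zero_mem _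
  · change v 0 - (v 0 - y) ∈ Y
    rwa [sub_sub_cancel]

/-- Let `X, Y ≤ A₈` contain `2A₈`, with `X/2A₈` and `Y/2A₈` `4`-dimensional totally
singular subspaces of `(A₈/2A₈, q)` and `X + Y = A₈`.  Let `Φ` be the subgroup of
`L = A₈³` generated by `{(α,-α,0) : α ∈ A₈}`, `{(γ,γ,γ) : γ ∈ X}` and `2L`, and `Ψ`
the one generated by `{(0,α,-α) : α ∈ A₈}`, `{(γ,γ,γ) : γ ∈ Y}` and `2L`.  Then
`Φ/2L` and `Ψ/2L` are `12`-dimensional (i.e. of cardinality `2¹² = 4096`) maximal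
totally singular subspaces of the `24`-dimensional quadratic `𝔽₂`-space `(L/2L, q)`
(total singularity meaning `4 ∣ ⟨v,v⟩` on the subgroup, and maximality meaning that
every totally singular subspace has cardinality at most `2¹²`), and `Φ + Ψ = L`. -/
theorem Phi_Psi_maximal_totally_singular
    (X Y : AddSubgroup (Fin 9 → ℤ))
    (hX2 : twoA8lat ≤ X) (hXA : X ≤ A8lat)
    (hY2 : twoA8lat ≤ Y) (hYA : Y ≤ A8lat)
    (hXsing : ∀ a ∈ X, (4 : ℤ) ∣ ∑ i, a i * a i)
    (hYsing : ∀ a ∈ Y, (4 : ℤ) ∣ ∑ i, a i * a i)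
    (hXdim : Nat.card (↥X ⧸ twoA8lat.addSubgroupOf X) = 16)
    (hYdim : Nat.card (↥Y ⧸ twoA8lat.addSubgroupOf Y) = 16)
    (hXY : X ⊔ Y = A8lat)
    (Phi Psi : AddSubgroup (Fin 3 → Fin 9 → ℤ))
    (hPhi : Phi = AddSubgroup.closure
      ({v | ∃ a : Fin 9 → ℤ, (∑ i, a i = 0) ∧ v = ![a, -a, 0]} ∪
       {v | ∃ g ∈ X, v = fun _ => g}) ⊔ twoLlat)
    (hPsi : Psi = AddSubgroup.closure
      ({v | ∃ a : Fin 9 → ℤ, (∑ i, a i = 0) ∧ v = ![0, a, -a]} ∪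
       {v | ∃ g ∈ Y, v = fun _ => g}) ⊔ twoLlat) :
    Phi ≤ Llat ∧ Psi ≤ Llat ∧
    (∀ v ∈ Phi, (4 : ℤ) ∣ ∑ k, ∑ i, v k i * v k i) ∧
    (∀ v ∈ Psi, (4 : ℤ) ∣ ∑ k, ∑ i, v k i * v k i) ∧
    Nat.card (↥Phi ⧸ twoLlat.addSubgroupOf Phi) = 4096 ∧
    Nat.card (↥Psi ⧸ twoLlat.addSubgroupOf Psi) = 4096 ∧
    (∀ Z : AddSubgroup (Fin 3 → Fin 9 → ℤ), twoLlat ≤ Z → Z ≤ Llat →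
      (∀ v ∈ Z, (4 : ℤ) ∣ ∑ k, ∑ i, v k i * v k i) →
      Nat.card (↥Z ⧸ twoLlat.addSubgroupOf Z) ≤ 4096) ∧
    Phi ⊔ Psi = Llat := by
  have hPhi' : Phi = gluedLattice 1 X := by
    rw [hPhi, ← closure_sup_twoLlat_eq_gluedLattice 1 hX2 hXA]
    have h : ∀ a : Fin 9 → ℤ, ![a, -a, 0] =
        (Pi.single ((1 : Equiv.Perm (Fin 3)) 0) a - Pi.single ((1 : Equiv.Perm (Fin 3)) 1) a :
          Fin 3 → Fin 9 → ℤ) := by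
      intro a
      funext k
      fin_cases k <;> simp
    simp only [h]
  have hPsi' : Psi = gluedLattice (finRotate 3) Y := by
    rw [hPsi, ← closure_sup_twoLlat_eq_gluedLattice (finRotate 3) hY2 hYA]
    have h : ∀ a : Fin 9 → ℤ, ![0, a, -a] =
        (Pi.single (finRotate 3 0) a - Pi.single (finRotate 3 1) a :
          Fin 3 → Fin 9 → ℤ) := by
      intro a
      funext k
      fin_cases k <;> simp
    simp only [h]
  subst hPhi' hPsi'
  exact ⟨fun v hv => hv.1, fun v hv => hv.1,
    fun v hv => four_dvd_of_mem_gluedLattice _ hXsing hv,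
    fun v hv => four_dvd_of_mem_gluedLattice _ hYsing hv,
    card_gluedLattice_quotient _ hXA hXdim, card_gluedLattice_quotient _ hYA hYdim,
    fun Z _ hZL hZ => card_quotient_le_of_totally_singular Z hZL hZ,
    gluedLattice_sup_eq_Llat hXA hYA hXY⟩
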